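/- Consider the model y = Xβ* + ε with ε ~ N(0, σ²I_n), where β* has support of cardinality s and columns of X satisfy ‖X_j‖₂² = n. Suppose X satisfies RE(3, s), λ = 2σ√(2 log(p/δ)/n) for δ ∈ (0,1), β̂ is a Lasso solution with tuning parameter λ, ŝ = |supp(β̂)|, and β̄ minimizes (1/2n)‖y − Xβ‖₂² over the set Γ = {β ∈ ℝᵖ : ‖β − β̂‖₁ ≤ ŝλ}. Then with probability at least 1 − δ, (1/n)‖X(β* − β̄)‖₂² ≤ (λ²s/κ²(3, s))·(9/4 + 9φ_max), where φ_max is the maximal eigenvalue of XᵀX/n. -/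

import Mathlib

open MeasureTheory ProbabilityTheory Finset

noncomputable section

/-- Product Gaussian measure `N(0, σ² I_n)` on `ℝⁿ`. -/
def gaussianVec (n : ℕ) (σ : ℝ) : Measure (Fin n → ℝ) :=
  Measure.pi fun _ => gaussianReal 0 (σ ^ 2).toNNReal

/-- Squared Euclidean norm. -/
def l2sq {m : ℕ} (v : Fin m → ℝ) : ℝ := ∑ i, (v i) ^ 2

/-- Euclidean norm. -/
def l2 {m : ℕ} (v : Fin m → ℝ) : ℝ := Real.sqrt (l2sq v)

/-- ℓ₁ norm. -/
def l1 {m : ℕ} (v : Fin m → ℝ) : ℝ := ∑ i, |v i|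

/-- Lasso objective `(1/2n)‖y − Xβ‖₂² + λ‖β‖₁`. -/
def lassoObj {n p : ℕ} (X : Matrix (Fin n) (Fin p) ℝ) (y : Fin n → ℝ) (lam : ℝ)
    (β : Fin p → ℝ) : ℝ :=
  l2sq (y - X.mulVec β) / (2 * (n : ℝ)) + lam * l1 β

/-- `b` is a Lasso solution with tuning parameter `lam`. -/
def IsLassoSol {n p : ℕ} (X : Matrix (Fin n) (Fin p) ℝ) (y : Fin n → ℝ) (lam : ℝ)
    (b : Fin p → ℝ) : Prop :=
  ∀ β : Fin p → ℝ, lassoObj X y lam b ≤ lassoObj X y lam β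

/-- Restricted eigenvalue condition RE(c₀, s) with constant `κ`:
for every `J` with `|J| ≤ s` and every `Δ` with `‖Δ_{Jᶜ}‖₁ ≤ c₀‖Δ_J‖₁`,
one has `‖XΔ‖₂² ≥ κ² n ‖Δ_J‖₂²`. -/
def RE {n p : ℕ} (X : Matrix (Fin n) (Fin p) ℝ) (c0 : ℝ) (s : ℕ) (κ : ℝ) : Prop :=
  0 < κ ∧ ∀ J : Finset (Fin p), J.card ≤ s → ∀ Δ : Fin p → ℝ,
    (∑ j ∈ Jᶜ, |Δ j|) ≤ c0 * ∑ j ∈ J, |Δ j| →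
    κ ^ 2 * ((n : ℝ) * ∑ j ∈ J, (Δ j) ^ 2) ≤ l2sq (X.mulVec Δ)

/-- The Lasso subgradient `ρ̂ = Xᵀ(y − Xβ̂)/(λ n)`. -/
def lassoSubgrad {n p : ℕ} (X : Matrix (Fin n) (Fin p) ℝ) (y : Fin n → ℝ) (lam : ℝ)
    (b : Fin p → ℝ) : Fin p → ℝ :=
  fun j => (X.transpose.mulVec (y - X.mulVec b)) j / (lam * (n : ℝ))

/-- Boosted Lasso objective `(1/2n)‖y − Xβ‖₂² + λ₂‖β − β̂‖₁`. -/
def boostedObj {n p : ℕ} (X : Matrix (Fin n) (Fin p) ℝ) (y : Fin n → ℝ) (lam2 : ℝ)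
    (bhat β : Fin p → ℝ) : ℝ :=
  l2sq (y - X.mulVec β) / (2 * (n : ℝ)) + lam2 * l1 (β - bhat)

/-- `b` is a Boosted Lasso solution built upon the first-step estimator `bhat`. -/
def IsBoostedSol {n p : ℕ} (X : Matrix (Fin n) (Fin p) ℝ) (y : Fin n → ℝ) (lam2 : ℝ)
    (bhat b : Fin p → ℝ) : Prop :=
  ∀ β : Fin p → ℝ, boostedObj X y lam2 bhat b ≤ boostedObj X y lam2 bhat β

/-- Bregman Lasso objective
`(1/2n)‖y − Xβ‖₂² + λ₂(‖β‖₁ − ⟨ρ̂^{λ₁}, β⟩)` where `ρ̂^{λ₁}` is the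
Lasso subgradient associated with `bhat`. -/
def bregmanObj {n p : ℕ} (X : Matrix (Fin n) (Fin p) ℝ) (y : Fin n → ℝ) (lam1 lam2 : ℝ)
    (bhat β : Fin p → ℝ) : ℝ :=
  l2sq (y - X.mulVec β) / (2 * (n : ℝ)) +
    lam2 * (l1 β - ∑ j, lassoSubgrad X y lam1 bhat j * β j)

/-- `b` is a Bregman Lasso solution with parameters `(lam1, lam2)`. -/
def IsBregmanSol {n p : ℕ} (X : Matrix (Fin n) (Fin p) ℝ) (y : Fin n → ℝ) (lam1 lam2 : ℝ)
    (bhat b : Fin p → ℝ) : Prop :=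
  ∀ β : Fin p → ℝ, bregmanObj X y lam1 lam2 bhat b ≤ bregmanObj X y lam1 lam2 bhat β

/-- `bbar` is a sign-consistent refitting of the Lasso solution `bhat`:
it does not increase the residual norm and `(1/n)Xᵀ(y − Xβ̂) ∈ λ·sign(β̄)`
componentwise. -/
def SignConsistentRefit {n p : ℕ} (X : Matrix (Fin n) (Fin p) ℝ) (y : Fin n → ℝ) (lam : ℝ)
    (bhat bbar : Fin p → ℝ) : Prop :=
  l2 (y - X.mulVec bbar) ≤ l2 (y - X.mulVec bhat) ∧
  ∀ j, (0 < bbar j → X.transpose.mulVec (y - X.mulVec bhat) j / (n : ℝ) = lam) ∧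
       (bbar j < 0 → X.transpose.mulVec (y - X.mulVec bhat) j / (n : ℝ) = -lam) ∧
       (bbar j = 0 → |X.transpose.mulVec (y - X.mulVec bhat) j / (n : ℝ)| ≤ lam)

/-- `bbar` is a Sign-Least-Squares Lasso refitting of the Lasso solution `bhat`:
it vanishes outside the equicorrelation set `E = {j : |ρ̂_j| = 1}` and minimizes
the residual sum of squares among all vectors supported on `E` whose coordinates
have signs compatible with `ρ̂_E`. -/
def IsSLSSol {n p : ℕ} (X : Matrix (Fin n) (Fin p) ℝ) (y : Fin n → ℝ) (lam : ℝ)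
    (bhat bbar : Fin p → ℝ) : Prop :=
  (∀ j, |lassoSubgrad X y lam bhat j| ≠ 1 → bbar j = 0) ∧
  (∀ j, 0 ≤ lassoSubgrad X y lam bhat j * bbar j) ∧
  ∀ β : Fin p → ℝ,
    ((∀ j, |lassoSubgrad X y lam bhat j| ≠ 1 → β j = 0) ∧
     (∀ j, 0 ≤ lassoSubgrad X y lam bhat j * β j)) →
    l2sq (y - X.mulVec bbar) ≤ l2sq (y - X.mulVec β)

/-- Componentwise soft-thresholding operator `softThresh(y, λ)_j = sign(y_j)(|y_j| − λ)₊`. -/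
def softThresh {p : ℕ} (y : Fin p → ℝ) (lam : ℝ) : Fin p → ℝ :=
  fun j => Real.sign (y j) * max (|y j| - lam) 0

/-- Componentwise firm-thresholding (MCP) operator. -/
def MCP {p : ℕ} (y : Fin p → ℝ) (μ γ : ℝ) : Fin p → ℝ :=
  fun j => if |y j| ≤ μ * γ then γ / (γ - 1) * (Real.sign (y j) * max (|y j| - μ) 0) else y j

/-- Bregman objective in the denoising (orthogonal, `X = I_p`) case:
`(1/2)‖y − β‖₂² + λ(‖β‖₁ − ⟨ρ, β⟩)`. -/
def denoiseBregObj {p : ℕ} (y ρ : Fin p → ℝ) (lam : ℝ) (β : Fin p → ℝ) : ℝ :=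
  (1 / 2) * l2sq (y - β) + lam * (l1 β - ∑ j, ρ j * β j)

end

open scoped Matrix

lemma l2sq_eq_dotProduct {m : ℕ} (v : Fin m → ℝ) : l2sq v = v ⬝ᵥ v := by
  simp [l2sq, dotProduct, sq]

lemma l2sq_nonneg {m : ℕ} (v : Fin m → ℝ) : 0 ≤ l2sq v :=
  Finset.sum_nonneg fun _ _ => sq_nonneg _

lemma l2sq_sub {m : ℕ} (u v : Fin m → ℝ) :
    l2sq (u - v) = l2sq u - 2 * (u ⬝ᵥ v) + l2sq v := by
  simp only [l2sq_eq_dotProduct, sub_dotProduct, dotProduct_sub, dotProduct_comm v u]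
  ring

lemma dotProduct_sq_le_l2sq_mul_l2sq {m : ℕ} (u v : Fin m → ℝ) :
    (u ⬝ᵥ v) ^ 2 ≤ l2sq u * l2sq v :=
  Finset.sum_mul_sq_le_sq_mul_sq _ _ _

/-- Hölder's inequality for the pairing of `Xᵀe` with `v`. -/
lemma abs_dotProduct_mulVec_le {n p : ℕ} {X : Matrix (Fin n) (Fin p) ℝ} {e : Fin n → ℝ} {c : ℝ}
    (hc : ∀ j, |(e ᵥ* X) j| ≤ c) (v : Fin p → ℝ) : |e ⬝ᵥ X *ᵥ v| ≤ c * l1 v := by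
  rw [Matrix.dotProduct_mulVec, dotProduct, l1, Finset.mul_sum]
  refine (Finset.abs_sum_le_sum_abs _ _).trans (Finset.sum_le_sum fun j _ => ?_)
  rw [abs_mul]
  exact mul_le_mul_of_nonneg_right (hc j) (abs_nonneg _)

lemma le_of_forall_le_mul_add {a c d : ℝ} (h : ∀ t : ℝ, 0 < t → t ≤ 1 → a ≤ t * c + d) :
    a ≤ d := by
  have hlim : Filter.Tendsto (fun t : ℝ => t * c + d) (nhdsWithin 0 (Set.Ioi 0)) (nhds d) := by
    have : Filter.Tendsto (fun t : ℝ => t * c + d) (nhds 0) (nhds (0 * c + d)) :=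
      (Continuous.tendsto (by fun_prop) 0)
    rw [zero_mul, zero_add] at this
    exact this.mono_left nhdsWithin_le_nhds
  refine ge_of_tendsto hlim ?_
  filter_upwards [Ioc_mem_nhdsGT (zero_lt_one' ℝ)] with t ht using h t ht.1 ht.2

/-- First-order optimality of a Lasso solution, as a variational inequality. -/
lemma IsLassoSol.dotProduct_le {n p : ℕ} (hn : 0 < n) {X : Matrix (Fin n) (Fin p) ℝ}
    {y : Fin n → ℝ} {lam : ℝ} (hlam : 0 ≤ lam) {b : Fin p → ℝ} (hb : IsLassoSol X y lam b)
    (β : Fin p → ℝ) :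
    (y - X *ᵥ b) ⬝ᵥ X *ᵥ (β - b) ≤ n * (lam * (l1 β - l1 b)) := by
  have hn' : (0 : ℝ) < n := by exact_mod_cast hn
  refine le_of_forall_le_mul_add (c := l2sq (X *ᵥ (β - b)) / 2) fun t ht0 ht1 => ?_
  have hconv : l1 (b + t • (β - b)) ≤ l1 b + t * (l1 β - l1 b) := by
    simp only [l1, ← Finset.sum_sub_distrib, Finset.mul_sum, ← Finset.sum_add_distrib]
    refine Finset.sum_le_sum fun j _ => ?_
    have h1 : (b + t • (β - b)) j = (1 - t) * b j + t * β j := by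
      simp [smul_eq_mul]; ring
    rw [h1]
    refine (abs_add_le _ _).trans (le_of_eq ?_)
    rw [abs_mul, abs_mul, abs_of_nonneg ht0.le, abs_of_nonneg (sub_nonneg.2 ht1)]
    ring
  have h := hb (b + t • (β - b))
  have hexp : l2sq (y - X *ᵥ (b + t • (β - b))) =
      l2sq (y - X *ᵥ b) - 2 * t * ((y - X *ᵥ b) ⬝ᵥ X *ᵥ (β - b)) +
        t ^ 2 * l2sq (X *ᵥ (β - b)) := by
    rw [Matrix.mulVec_add, ← sub_sub, l2sq_sub, Matrix.mulVec_smul, dotProduct_smul]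
    simp only [l2sq_eq_dotProduct (t • _), dotProduct_smul, smul_dotProduct, smul_eq_mul,
      l2sq_eq_dotProduct (X *ᵥ (β - b))]
    ring
  unfold lassoObj at h
  rw [hexp] at h
  have h2 := mul_le_mul_of_nonneg_left hconv hlam
  have h3 : l2sq (y - X *ᵥ b) / (2 * (n : ℝ)) + lam * l1 b ≤
      (l2sq (y - X *ᵥ b) - 2 * t * ((y - X *ᵥ b) ⬝ᵥ X *ᵥ (β - b)) +
        t ^ 2 * l2sq (X *ᵥ (β - b))) / (2 * (n : ℝ)) + lam * (l1 b + t * (l1 β - l1 b)) := by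
    linarith
  have h4 := mul_le_mul_of_nonneg_left h3 (by positivity : (0 : ℝ) ≤ 2 * n)
  field_simp at h4
  refine le_of_mul_le_mul_left (a := 2 * t) ?_ (by positivity)
  linarith

/-- The Lasso stationarity condition is tight on the support of the solution. -/
lemma IsLassoSol.le_abs_vecMul {n p : ℕ} (hn : 0 < n) {X : Matrix (Fin n) (Fin p) ℝ}
    {y : Fin n → ℝ} {lam : ℝ} (hlam : 0 ≤ lam) {b : Fin p → ℝ} (hb : IsLassoSol X y lam b)
    {j : Fin p} (hj : b j ≠ 0) : n * lam ≤ |((y - X *ᵥ b) ᵥ* X) j| := by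
  have h := hb.dotProduct_le hn hlam (b - Pi.single j (b j))
  have hd : b - Pi.single j (b j) - b = -Pi.single j (b j) := by abel
  have hl : l1 (b - Pi.single j (b j)) - l1 b = -|b j| := by
    simp only [l1, ← Finset.sum_sub_distrib]
    rw [Finset.sum_eq_single j]
    · simp
    · intro i _ hij
      simp [Pi.single_eq_of_ne hij]
    · simp
  rw [hd, hl, Matrix.mulVec_neg, dotProduct_neg, Matrix.dotProduct_mulVec,
    dotProduct_single] at h
  have h1 : ((y - X *ᵥ b) ᵥ* X) j * b j ≤ |((y - X *ᵥ b) ᵥ* X) j| * |b j| := by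
    rw [← abs_mul]; exact le_abs_self _
  refine le_of_mul_le_mul_right (a := |b j|) ?_ (abs_pos.2 hj)
  linarith

/-- Fast-rate prediction bound for the Lasso on the event `‖Xᵀe‖_∞ ≤ nλ/2`. -/
lemma IsLassoSol.prediction_le {n p : ℕ} (hn : 0 < n) {X : Matrix (Fin n) (Fin p) ℝ}
    {bstar : Fin p → ℝ} {e : Fin n → ℝ} {lam : ℝ} (hlam : 0 < lam) {b : Fin p → ℝ}
    (hb : IsLassoSol X (X *ᵥ bstar + e) lam b) (he : ∀ j, |(e ᵥ* X) j| ≤ n * lam / 2)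
    {κ : ℝ} (hRE : RE X 3 (Finset.univ.filter fun j => bstar j ≠ 0).card κ) :
    κ ^ 2 * l2sq (X *ᵥ (bstar - b)) ≤
      n * (9 / 4 * lam ^ 2 * (Finset.univ.filter fun j => bstar j ≠ 0).card) := by
  have hn' : (0 : ℝ) < n := by exact_mod_cast hn
  set J := Finset.univ.filter fun j => bstar j ≠ 0 with hJ
  set Δ := bstar - b with hΔ
  set A := ∑ j ∈ J, |Δ j| with hA
  set B := ∑ j ∈ Jᶜ, |Δ j| with hB
  have hl1 : l1 Δ = A + B := (Finset.sum_add_sum_compl J _).symm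
  have hdiff : l1 bstar - l1 b ≤ A - B := by
    rw [l1, l1, ← Finset.sum_sub_distrib, ← Finset.sum_add_sum_compl J, sub_eq_add_neg A, hA, hB,
      ← Finset.sum_neg_distrib]
    refine add_le_add (Finset.sum_le_sum fun j _ => abs_sub_abs_le_abs_sub _ _)
      (Finset.sum_le_sum fun j hj => ?_)
    have hj0 : bstar j = 0 := by simpa [hJ] using hj
    simp [hΔ, hj0]
  have hvar := hb.dotProduct_le hn hlam.le bstar
  have hres : X *ᵥ bstar + e - X *ᵥ b = X *ᵥ Δ + e := by
    rw [hΔ, Matrix.mulVec_sub]; abel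
  rw [hres, add_dotProduct, ← l2sq_eq_dotProduct] at hvar
  have hnoise := (abs_le.1 (abs_dotProduct_mulVec_le he Δ)).1
  rw [hl1] at hnoise
  have hd' := mul_le_mul_of_nonneg_left hdiff (mul_pos hn' hlam).le
  have hbound : l2sq (X *ᵥ Δ) ≤ n * lam * (3 / 2 * A - B / 2) := by linarith
  have hB0 : 0 ≤ B := Finset.sum_nonneg fun _ _ => abs_nonneg _
  have hQ0 := l2sq_nonneg (X *ᵥ Δ)
  have hcone : B ≤ 3 * A := by
    by_contra hlt
    push Not at hlt
    have : n * lam * (3 / 2 * A - B / 2) < 0 :=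
      mul_neg_of_pos_of_neg (mul_pos hn' hlam) (by linarith)
    linarith
  have hre := hRE.2 J le_rfl Δ hcone
  have hCS : A ^ 2 ≤ J.card * ∑ j ∈ J, Δ j ^ 2 := by
    simpa using sq_sum_le_card_mul_sum_sq (s := J) (f := fun j => |Δ j|)
  set Q := l2sq (X *ᵥ Δ)
  have hQA : Q ≤ n * lam * (3 / 2 * A) := hbound.trans (by gcongr; linarith)
  rcases hQ0.eq_or_lt with h0 | hpos
  · rw [← h0, mul_zero]; positivity
  refine le_of_mul_le_mul_right (a := Q) ?_ hpos
  calc κ ^ 2 * Q * Q = κ ^ 2 * Q ^ 2 := by ring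
    _ ≤ κ ^ 2 * (n * lam * (3 / 2 * A)) ^ 2 := by gcongr
    _ = n * (9 / 4 * lam ^ 2) * (κ ^ 2 * (n * A ^ 2)) := by ring
    _ ≤ n * (9 / 4 * lam ^ 2) * (κ ^ 2 * (n * (J.card * ∑ j ∈ J, Δ j ^ 2))) := by gcongr
    _ = n * (9 / 4 * lam ^ 2) * (J.card * (κ ^ 2 * (n * ∑ j ∈ J, Δ j ^ 2))) := by ring
    _ ≤ n * (9 / 4 * lam ^ 2) * (J.card * Q) := by gcongr
    _ = _ := by ring

lemma l2sq_vecMul_le {n p : ℕ} {X : Matrix (Fin n) (Fin p) ℝ} {c : ℝ} (hc : 0 ≤ c)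
    (hX : ∀ v, l2sq (X *ᵥ v) ≤ c * l2sq v) (u : Fin n → ℝ) :
    l2sq (u ᵥ* X) ≤ c * l2sq u := by
  set w := u ᵥ* X with hw
  rcases (l2sq_nonneg w).eq_or_lt with h0 | hpos
  · rw [← h0]
    exact mul_nonneg hc (l2sq_nonneg u)
  · refine le_of_mul_le_mul_right (a := l2sq w) ?_ hpos
    calc l2sq w * l2sq w = (u ⬝ᵥ X *ᵥ w) ^ 2 := by
          rw [Matrix.dotProduct_mulVec, ← hw, ← l2sq_eq_dotProduct, sq]
      _ ≤ l2sq u * l2sq (X *ᵥ w) := dotProduct_sq_le_l2sq_mul_l2sq _ _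
      _ ≤ l2sq u * (c * l2sq w) := mul_le_mul_of_nonneg_left (hX w) (l2sq_nonneg u)
      _ = c * l2sq u * l2sq w := by ring

lemma gaussianPDFReal_add_le {v : NNReal} {t x : ℝ} (ht : 0 ≤ t) (hx : 0 ≤ x) :
    gaussianPDFReal 0 v (x + t) ≤ Real.exp (-t ^ 2 / (2 * v)) * gaussianPDFReal 0 v x := by
  rw [gaussianPDFReal_def]
  dsimp only
  rw [mul_left_comm, ← Real.exp_add, ← add_div]
  gcongr
  nlinarith [mul_nonneg ht hx]

lemma two_mul_gaussianReal_Ioi_zero_le {v : NNReal} :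
    2 * gaussianReal 0 v (Set.Ioi 0) ≤ 1 := by
  have hsymm : gaussianReal 0 v (Set.Iio 0) = gaussianReal 0 v (Set.Ioi 0) := by
    have h := congrArg (fun μ : Measure ℝ => μ (Set.Ioi 0)) (gaussianReal_map_neg (μ := 0) (v := v))
    rw [neg_zero] at h
    rw [← h, Measure.map_apply measurable_neg measurableSet_Ioi]
    congr 1
    ext x
    simp
  rw [two_mul]
  nth_rewrite 1 [← hsymm]
  have hdisj : Disjoint (Set.Iio (0 : ℝ)) (Set.Ioi 0) :=
    Set.disjoint_left.2 fun x h1 h2 => lt_asymm (Set.mem_Iio.1 h1) (Set.mem_Ioi.1 h2)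
  rw [← measure_union hdisj measurableSet_Ioi]
  exact prob_le_one

lemma gaussianReal_Ioi_le {v : NNReal} (hv : v ≠ 0) {t : ℝ} (ht : 0 ≤ t) :
    gaussianReal 0 v (Set.Ioi t) ≤
      ENNReal.ofReal (Real.exp (-t ^ 2 / (2 * v))) * gaussianReal 0 v (Set.Ioi 0) := by
  have hshift : gaussianReal 0 v (Set.Ioi t) = gaussianReal (-t) v (Set.Ioi 0) := by
    have h := gaussianReal_map_sub_const (μ := 0) (v := v) t
    rw [zero_sub] at h
    rw [← h, Measure.map_apply (by fun_prop) measurableSet_Ioi]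
    congr 1
    ext x
    simp
  rw [hshift, gaussianReal_apply _ hv, gaussianReal_apply _ hv,
    ← lintegral_const_mul _ (measurable_gaussianPDF _ _)]
  refine setLIntegral_mono (by fun_prop) fun x hx => ?_
  rw [gaussianPDF, gaussianPDF, ← ENNReal.ofReal_mul (Real.exp_nonneg _), ← zero_sub t,
    ← gaussianPDFReal_add]
  exact ENNReal.ofReal_le_ofReal (gaussianPDFReal_add_le ht (le_of_lt hx))

/-- Two-sided Gaussian tail bound with the sharp constant `1`. -/
lemma gaussianReal_lt_abs_le {v : NNReal} (hv : v ≠ 0) {t : ℝ} (ht : 0 ≤ t) :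
    gaussianReal 0 v {x | t < |x|} ≤ ENNReal.ofReal (Real.exp (-t ^ 2 / (2 * v))) := by
  have hsymm : gaussianReal 0 v (Set.Iio (-t)) = gaussianReal 0 v (Set.Ioi t) := by
    have h := congrArg (fun μ : Measure ℝ => μ (Set.Ioi t)) (gaussianReal_map_neg (μ := 0) (v := v))
    rw [neg_zero] at h
    rw [← h, Measure.map_apply measurable_neg measurableSet_Ioi]
    congr 1
    ext x
    simp
  have hset : {x : ℝ | t < |x|} = Set.Iio (-t) ∪ Set.Ioi t := by
    ext x
    simp only [Set.mem_ofPred_eq, lt_abs, Set.mem_union, Set.mem_Iio, Set.mem_Ioi, lt_neg, or_comm]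
  calc gaussianReal 0 v {x | t < |x|}
      ≤ gaussianReal 0 v (Set.Ioi t) + gaussianReal 0 v (Set.Ioi t) := by
        rw [hset]; nth_rewrite 1 [← hsymm]; exact measure_union_le _ _
    _ = 2 * gaussianReal 0 v (Set.Ioi t) := (two_mul _).symm
    _ ≤ 2 * (ENNReal.ofReal (Real.exp (-t ^ 2 / (2 * v))) * gaussianReal 0 v (Set.Ioi 0)) := by
        gcongr; exact gaussianReal_Ioi_le hv ht
    _ = ENNReal.ofReal (Real.exp (-t ^ 2 / (2 * v))) * (2 * gaussianReal 0 v (Set.Ioi 0)) := by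
        ring
    _ ≤ ENNReal.ofReal (Real.exp (-t ^ 2 / (2 * v))) * 1 := by
        gcongr; exact two_mul_gaussianReal_Ioi_zero_le
    _ = _ := mul_one _

instance (n : ℕ) (σ : ℝ) : IsProbabilityMeasure (gaussianVec n σ) := by
  unfold gaussianVec; infer_instance

/-- A linear functional of an isotropic Gaussian vector is Gaussian. -/
lemma gaussianVec_map_dotProduct (n : ℕ) (σ : ℝ) (a : Fin n → ℝ) :
    (gaussianVec n σ).map (fun e => e ⬝ᵥ a) = gaussianReal 0 (l2sq a * σ ^ 2).toNNReal := by
  have hmeas : Measurable fun e : Fin n → ℝ => e ⬝ᵥ a := by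
    unfold dotProduct; fun_prop
  have := Measure.isProbabilityMeasure_map (μ := gaussianVec n σ) hmeas.aemeasurable
  refine Measure.ext_of_charFun (funext fun t => ?_)
  rw [charFun_apply_real, integral_map hmeas.aemeasurable (by fun_prop)]
  have hprod : ∀ e : Fin n → ℝ, Complex.exp (t * ↑(e ⬝ᵥ a) * Complex.I) =
      ∏ i, Complex.exp (↑(t * a i) * ↑(e i) * Complex.I) := fun e => by
    rw [← Complex.exp_sum, dotProduct]
    push_cast
    rw [Finset.mul_sum, Finset.sum_mul]
    congr 1
    exact Finset.sum_congr rfl fun i _ => by ring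
  simp_rw [hprod]
  rw [gaussianVec, integral_fintype_prod_eq_prod
    (f := fun i (x : ℝ) => Complex.exp (↑(t * a i) * ↑x * Complex.I))]
  simp_rw [← charFun_apply_real, charFun_gaussianReal]
  rw [← Complex.exp_sum]
  congr 1
  have h1 : (((σ ^ 2).toNNReal : ℝ)) = σ ^ 2 := Real.coe_toNNReal _ (sq_nonneg _)
  have h2 : (((l2sq a * σ ^ 2).toNNReal : ℝ)) = l2sq a * σ ^ 2 :=
    Real.coe_toNNReal _ (mul_nonneg (l2sq_nonneg a) (sq_nonneg _))
  have h1' : (((σ ^ 2).toNNReal : ℝ) : ℂ) = σ ^ 2 := by rw [h1]; push_cast; rfl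
  have h2' : (((l2sq a * σ ^ 2).toNNReal : ℝ) : ℂ) = l2sq a * σ ^ 2 := by rw [h2]; push_cast; rfl
  rw [h1', h2', l2sq]
  push_cast
  simp only [mul_zero, zero_mul, zero_sub, Finset.sum_mul, Finset.sum_div, ← Finset.sum_neg_distrib]
  exact Finset.sum_congr rfl fun i _ => by ring

/-- Maximal inequality for the correlations of Gaussian noise with normalized columns. -/
lemma le_gaussianVec_forall_abs_vecMul_le {n p : ℕ} (hn : 0 < n) (hp : 0 < p) {σ : ℝ} (hσ : 0 < σ)
    {X : Matrix (Fin n) (Fin p) ℝ} (hX : ∀ j, ∑ i, (X i j) ^ 2 = (n : ℝ))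
    {δ : ℝ} (hδ : δ ∈ Set.Ioo (0 : ℝ) 1) :
    ENNReal.ofReal (1 - δ) ≤ gaussianVec n σ {e | ∀ j, |(e ᵥ* X) j| ≤
      n * (2 * σ * √(2 * Real.log (p / δ) / n)) / 2} := by
  have hn' : (0 : ℝ) < n := by exact_mod_cast hn
  have hp' : (0 : ℝ) < p := by exact_mod_cast hp
  have hlog : 0 ≤ Real.log (p / δ) := Real.log_nonneg <| by
    rw [le_div_iff₀ hδ.1, one_mul]
    exact hδ.2.le.trans (by exact_mod_cast hp)
  set t := n * (2 * σ * √(2 * Real.log (p / δ) / n)) / 2 with ht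
  have ht0 : 0 ≤ t := by positivity
  have hmeas : ∀ j, Measurable fun e : Fin n → ℝ => (e ᵥ* X) j := fun j => by
    unfold Matrix.vecMul dotProduct; fun_prop
  have hv : (n * σ ^ 2).toNNReal ≠ 0 := by
    simpa using by positivity
  have htail : ∀ j, gaussianVec n σ {e | t < |(e ᵥ* X) j|} ≤ ENNReal.ofReal (δ / p) := fun j => by
    have hmap : (gaussianVec n σ).map (fun e => (e ᵥ* X) j) = gaussianReal 0 (n * σ ^ 2).toNNReal := by
      rw [← hX j]
      exact gaussianVec_map_dotProduct n σ fun i => X i j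
    have hle := gaussianReal_lt_abs_le hv ht0
    rw [← hmap, Measure.map_apply (hmeas j)
      (measurableSet_lt measurable_const measurable_abs)] at hle
    refine hle.trans (ENNReal.ofReal_le_ofReal (le_of_eq ?_))
    have hexp : -t ^ 2 / (2 * ((n * σ ^ 2).toNNReal : ℝ)) = -Real.log (p / δ) := by
      rw [Real.coe_toNNReal _ (by positivity), ht, div_pow, mul_pow, mul_pow,
        Real.sq_sqrt (by positivity)]
      field_simp
    rw [hexp, Real.exp_neg, Real.exp_log (div_pos hp' hδ.1), inv_div]
  have hbad : gaussianVec n σ {e | ∀ j, |(e ᵥ* X) j| ≤ t}ᶜ ≤ ENNReal.ofReal δ := by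
    have hset : {e : Fin n → ℝ | ∀ j, |(e ᵥ* X) j| ≤ t}ᶜ = ⋃ j, {e | t < |(e ᵥ* X) j|} := by
      ext e; simp
    rw [hset]
    calc _ ≤ ∑ j, gaussianVec n σ {e | t < |(e ᵥ* X) j|} := measure_iUnion_fintype_le _ _
      _ ≤ ∑ _j : Fin p, ENNReal.ofReal (δ / p) := Finset.sum_le_sum fun j _ => htail j
      _ = ENNReal.ofReal δ := by
        rw [Finset.sum_const, Finset.card_univ, Fintype.card_fin, nsmul_eq_mul,
          ← ENNReal.ofReal_natCast, ← ENNReal.ofReal_mul hp'.le, mul_div_cancel₀ _ hp'.ne']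
  have hms : MeasurableSet {e : Fin n → ℝ | ∀ j, |(e ᵥ* X) j| ≤ t} := by
    simp only [Set.ofPred_forall]
    exact MeasurableSet.iInter fun j => measurableSet_le (hmeas j).norm measurable_const
  rw [ENNReal.ofReal_sub _ hδ.1.le, ENNReal.ofReal_one, tsub_le_iff_right,
    ← prob_add_prob_compl (μ := gaussianVec n σ) hms]
  gcongr

/-- The Lasso selects `O(s)` variables on the event `‖Xᵀe‖_∞ ≤ nλ/2`. -/
lemma IsLassoSol.card_support_mul_le {n p : ℕ} (hn : 0 < n) {X : Matrix (Fin n) (Fin p) ℝ}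
    {bstar : Fin p → ℝ} {e : Fin n → ℝ} {lam : ℝ} (hlam : 0 ≤ lam) {b : Fin p → ℝ}
    (hb : IsLassoSol X (X *ᵥ bstar + e) lam b) (he : ∀ j, |(e ᵥ* X) j| ≤ n * lam / 2)
    {c : ℝ} (hc : 0 ≤ c) (hX : ∀ v, l2sq (X *ᵥ v) ≤ c * l2sq v) :
    (Finset.univ.filter fun j => b j ≠ 0).card * (n * lam / 2) ^ 2 ≤
      c * l2sq (X *ᵥ (bstar - b)) := by
  refine le_trans ?_ (l2sq_vecMul_le hc hX _)
  rw [← nsmul_eq_mul, ← Finset.sum_const]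
  refine (Finset.sum_le_sum fun j hj => ?_).trans
    (Finset.sum_le_sum_of_subset_of_nonneg (Finset.subset_univ _) fun _ _ _ => sq_nonneg _)
  rw [← sq_abs (((X *ᵥ (bstar - b)) ᵥ* X) j)]
  have h1 := hb.le_abs_vecMul hn hlam (Finset.mem_filter.1 hj).2
  have hres : X *ᵥ bstar + e - X *ᵥ b = X *ᵥ (bstar - b) + e := by
    rw [Matrix.mulVec_sub]; abel
  rw [hres, Matrix.add_vecMul, Pi.add_apply] at h1
  have h2 := abs_add_le (((X *ᵥ (bstar - b)) ᵥ* X) j) ((e ᵥ* X) j)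
  have h3 := he j
  gcongr
  linarith

/-- A refitting that lowers the residual within an `ℓ₁`-ball around `b` of radius `r` loses at most
`2cr` in squared prediction error, where `c` bounds the noise correlations. -/
lemma l2sq_mulVec_sub_le_of_residual_le {n p : ℕ} {X : Matrix (Fin n) (Fin p) ℝ}
    {bstar b bbar : Fin p → ℝ} {e : Fin n → ℝ} {c r : ℝ} (hc : 0 ≤ c)
    (he : ∀ j, |(e ᵥ* X) j| ≤ c) (hr : l1 (bbar - b) ≤ r)
    (hres : l2sq (X *ᵥ bstar + e - X *ᵥ bbar) ≤ l2sq (X *ᵥ bstar + e - X *ᵥ b)) :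
    l2sq (X *ᵥ (bstar - bbar)) ≤ l2sq (X *ᵥ (bstar - b)) + 2 * (c * r) := by
  have hexp : ∀ β : Fin p → ℝ, l2sq (X *ᵥ bstar + e - X *ᵥ β) =
      l2sq e - 2 * (e ⬝ᵥ X *ᵥ (β - bstar)) + l2sq (X *ᵥ (bstar - β)) := fun β => by
    have h1 : X *ᵥ bstar + e - X *ᵥ β = e - X *ᵥ (β - bstar) := by
      rw [Matrix.mulVec_sub]; abel
    have h2 : X *ᵥ (bstar - β) = -(X *ᵥ (β - bstar)) := by
      rw [← Matrix.mulVec_neg, neg_sub]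
    rw [h1, l2sq_sub, h2]
    simp [l2sq]
  rw [hexp, hexp] at hres
  have hsub : e ⬝ᵥ X *ᵥ (bbar - b) = e ⬝ᵥ X *ᵥ (bbar - bstar) - e ⬝ᵥ X *ᵥ (b - bstar) := by
    rw [← dotProduct_sub, ← Matrix.mulVec_sub, sub_sub_sub_cancel_right]
  have h3 := (le_abs_self _).trans (abs_dotProduct_mulVec_le he (bbar - b))
  have h4 := mul_le_mul_of_nonneg_left hr hc
  linarith

theorem stmt4 (n p s : ℕ) (hn : 0 < n) (hp : 0 < p) (σ : ℝ) (hσ : 0 < σ)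
    (X : Matrix (Fin n) (Fin p) ℝ)
    (hX : ∀ j, ∑ i, (X i j) ^ 2 = (n : ℝ))
    (bstar : Fin p → ℝ)
    (hs : (Finset.univ.filter fun j => bstar j ≠ 0).card = s)
    (κ3 : ℝ) (hRE : RE X 3 s κ3)
    (φmax : ℝ)
    (hφ : (∀ v : Fin p → ℝ, l2sq (X.mulVec v) ≤ φmax * ((n : ℝ) * l2sq v)) ∧
          ∃ v : Fin p → ℝ, v ≠ 0 ∧ l2sq (X.mulVec v) = φmax * ((n : ℝ) * l2sq v))
    (δ : ℝ) (hδ : δ ∈ Set.Ioo (0 : ℝ) 1)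
    (lam : ℝ) (hlam : lam = 2 * σ * Real.sqrt (2 * Real.log ((p : ℝ) / δ) / (n : ℝ))) :
    ENNReal.ofReal (1 - δ) ≤
      gaussianVec n σ
        {ε | ∀ bhat bbar : Fin p → ℝ,
          IsLassoSol X (X.mulVec bstar + ε) lam bhat →
          (l1 (bbar - bhat) ≤ ((Finset.univ.filter fun j => bhat j ≠ 0).card : ℝ) * lam ∧
            ∀ β : Fin p → ℝ,
              l1 (β - bhat) ≤ ((Finset.univ.filter fun j => bhat j ≠ 0).card : ℝ) * lam →
              l2sq (X.mulVec bstar + ε - X.mulVec bbar) ≤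
                l2sq (X.mulVec bstar + ε - X.mulVec β)) →
          l2sq (X.mulVec (bstar - bbar)) / (n : ℝ) ≤
            lam ^ 2 * (s : ℝ) / κ3 ^ 2 * (9 / 4 + 9 * φmax)} := by
  have hn' : (0 : ℝ) < n := by exact_mod_cast hn
  have hlog : 0 < Real.log (p / δ) := Real.log_pos <| by
    rw [lt_div_iff₀ hδ.1, one_mul]
    exact hδ.2.trans_le (by exact_mod_cast hp)
  have hlam0 : 0 < lam := by rw [hlam]; positivity
  have hφ0 : 0 ≤ φmax := by
    obtain ⟨v, hv, hveq⟩ := hφ.2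
    have hvpos : 0 < l2sq v := (l2sq_nonneg v).lt_of_ne' fun h =>
      hv (dotProduct_self_eq_zero.1 ((l2sq_eq_dotProduct v).symm.trans h))
    exact nonneg_of_mul_nonneg_left (hveq ▸ l2sq_nonneg _) (mul_pos hn' hvpos)
  refine (le_gaussianVec_forall_abs_vecMul_le hn hp hσ hX hδ).trans (measure_mono ?_)
  rw [← hlam]
  rintro e he bhat bbar hlasso ⟨hball, hmin⟩
  set k := (Finset.univ.filter fun j => bhat j ≠ 0).card
  have hcenter : l1 (bhat - bhat) ≤ k * lam := by
    rw [sub_self]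
    simpa [l1] using mul_nonneg k.cast_nonneg hlam0.le
  have hrefit := l2sq_mulVec_sub_le_of_residual_le (by positivity) he hball (hmin _ hcenter)
  have hpred := hlasso.prediction_le hn hlam0 he (hs.symm ▸ hRE)
  rw [hs] at hpred
  have hcard := hlasso.card_support_mul_le hn hlam0.le he (mul_nonneg hφ0 hn'.le)
    fun v => (hφ.1 v).trans_eq (mul_assoc _ _ _).symm
  have hκ : 0 < κ3 ^ 2 := pow_pos hRE.1 2
  set Q := l2sq (X.mulVec (bstar - bhat))
  have hQ : Q / n ≤ 9 / 4 * lam ^ 2 * s / κ3 ^ 2 := by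
    rw [div_le_div_iff₀ hn' hκ]
    linarith
  have hk : k * lam ^ 2 ≤ 4 * φmax * (Q / n) := by
    rw [← mul_div_assoc, le_div_iff₀ hn']
    refine le_of_mul_le_mul_right (a := (n : ℝ)) ?_ hn'
    linarith
  calc l2sq (X.mulVec (bstar - bbar)) / n
      ≤ (Q + 2 * (n * lam / 2 * (k * lam))) / n := by gcongr
    _ = Q / n + k * lam ^ 2 := by field_simp
    _ ≤ Q / n + 4 * φmax * (Q / n) := by gcongr
    _ = (1 + 4 * φmax) * (Q / n) := by ring
    _ ≤ (1 + 4 * φmax) * (9 / 4 * lam ^ 2 * s / κ3 ^ 2) := by gcongr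
    _ = _ := by ring
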